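/- Let P be a polynomial with complex coefficients of degree n having no zeros in the open unit disk {z : |z| < 1}, and let a be a complex number with |a| ≤ 1. Then for every complex z with |z| ≥ 1, |(1+az)P′(z) − n·a·P(z)| ≤ (1/2)·( n|z|^(n−1) + n|a| ) · max_{|w|=1} |P(w)|. -/

import Mathlib

open Polynomial

/-- The modified Smirnov operator: S̃ₐ[P](z) = (1+az)·P′(z) − n·a·P(z). -/
noncomputable def smirnov (n : ℕ) (a : ℂ) (P : Polynomial ℂ) (z : ℂ) : ℂ :=
  (1 + a * z) * P.derivative.eval z - (n : ℂ) * a * P.eval z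

/-- The maximum of ‖P‖ on the unit circle. -/
noncomputable def maxCircle (P : Polynomial ℂ) : ℝ :=
  sSup {y : ℝ | ∃ w : ℂ, ‖w‖ = 1 ∧ y = ‖P.eval w‖}

open ComplexConjugate Filter Topology

/-- The polar derivative `n f + (α - X) f'` of `f`, regarded as a polynomial of degree `n`,
with respect to the point `α`. -/
noncomputable def polarDeriv (n : ℕ) (α : ℂ) (f : ℂ[X]) : ℂ[X] :=
  C (n : ℂ) * f + (C α - X) * derivative f

lemma eval_polarDeriv (n : ℕ) (α w : ℂ) (f : ℂ[X]) :
    (polarDeriv n α f).eval w = n * f.eval w + (α - w) * f.derivative.eval w := by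
  simp [polarDeriv]

lemma polarDeriv_sub (n : ℕ) (α : ℂ) (f g : ℂ[X]) :
    polarDeriv n α (f - g) = polarDeriv n α f - polarDeriv n α g := by
  simp only [polarDeriv, derivative_sub]
  ring

lemma polarDeriv_C_mul (n : ℕ) (α c : ℂ) (f : ℂ[X]) :
    polarDeriv n α (C c * f) = C c * polarDeriv n α f := by
  simp only [polarDeriv, derivative_C_mul]
  ring

/-- For `‖w‖ < 1`, the inequality `‖b‖ ≤ ‖1 - w * b‖` describes a closed disk in `b`. -/
lemma norm_le_norm_sub_mul_iff {w : ℂ} (hw : ‖w‖ < 1) {N : ℝ} (hN : 0 ≤ N) (b : ℂ) :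
    ‖b‖ ≤ ‖N - w * b‖ ↔ ‖b * ((1 - ‖w‖ ^ 2 : ℝ) : ℂ) + N * conj w‖ ≤ N := by
  have hpos : 0 < 1 - ‖w‖ ^ 2 := by nlinarith [norm_nonneg w]
  rw [← sq_le_sq₀ (norm_nonneg _) (norm_nonneg _), ← sq_le_sq₀ (norm_nonneg _) hN]
  rw [← mul_le_mul_iff_right₀ hpos, ← sub_nonneg, ← sub_nonneg (b := _ ^ 2) (a := N ^ 2)]
  have key : (1 - ‖w‖ ^ 2) * ‖N - w * b‖ ^ 2 - (1 - ‖w‖ ^ 2) * ‖b‖ ^ 2 =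
      N ^ 2 - ‖b * ((1 - ‖w‖ ^ 2 : ℝ) : ℂ) + N * conj w‖ ^ 2 := by
    simp only [Complex.sq_norm, Complex.normSq_apply, Complex.sub_re, Complex.sub_im,
      Complex.add_re, Complex.add_im, Complex.mul_re, Complex.mul_im, Complex.ofReal_re,
      Complex.ofReal_im, Complex.conj_re, Complex.conj_im]
    ring
  rw [key]

lemma norm_one_sub_mul_le {w u : ℂ} (hw : ‖w‖ ≤ 1) (hu : 1 ≤ ‖u‖) :
    ‖1 - w * u‖ ≤ ‖conj w - u‖ := by
  rw [← sq_le_sq₀ (norm_nonneg _) (norm_nonneg _), ← sub_nonneg]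
  have key : ‖conj w - u‖ ^ 2 - ‖1 - w * u‖ ^ 2 = (1 - ‖w‖ ^ 2) * (‖u‖ ^ 2 - 1) := by
    simp only [Complex.sq_norm, Complex.normSq_apply, Complex.sub_re, Complex.sub_im,
      Complex.mul_re, Complex.mul_im, Complex.conj_re, Complex.conj_im, Complex.one_re,
      Complex.one_im]
    ring
  rw [key]
  exact mul_nonneg (by nlinarith [norm_nonneg w]) (by nlinarith)

lemma norm_multiset_sum_add_card_mul_le {c : ℂ} {κ R : ℝ} (s : Multiset ℂ)
    (g : ℂ → ℂ) (h : ∀ u ∈ s, ‖g u * κ + c‖ ≤ R) :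
    ‖(s.map g).sum * κ + s.card * c‖ ≤ s.card * R := by
  induction s using Multiset.induction_on with
  | empty => simp
  | cons u s ih =>
    have h1 := h u (Multiset.mem_cons_self u s)
    have h2 := ih fun v hv => h v (Multiset.mem_cons_of_mem hv)
    rw [Multiset.map_cons, Multiset.sum_cons, Multiset.card_cons]
    push_cast
    calc _ = ‖(g u * κ + c) + ((s.map g).sum * κ + s.card * c)‖ := by congr 1; ring
      _ ≤ _ := norm_add_le _ _
      _ ≤ _ := by linarith

/-- If `f` has degree at most `n` and no zeros in the open unit disk, then `f'` is dominated there
by `n f - X f'` in absolute value. -/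
lemma norm_eval_derivative_le {n : ℕ} {f : ℂ[X]} (hf : f.natDegree ≤ n)
    (hf0 : ∀ w : ℂ, ‖w‖ < 1 → f.eval w ≠ 0) {w : ℂ} (hw : ‖w‖ < 1) :
    ‖f.derivative.eval w‖ ≤ ‖n * f.eval w - w * f.derivative.eval w‖ := by
  have hfw := hf0 w hw
  have hlog : f.derivative.eval w / f.eval w = (f.roots.map fun u => 1 / (w - u)).sum :=
    (IsAlgClosed.splits f).eval_derivative_div_eval_of_ne_zero hfw
  have hroot : ∀ u ∈ f.roots, ‖1 / (w - u) * ((1 - ‖w‖ ^ 2 : ℝ) : ℂ) + conj w‖ ≤ 1 := by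
    intro u hu
    have hu1 : 1 ≤ ‖u‖ := by
      by_contra! h
      exact hf0 u h (isRoot_of_mem_roots hu)
    have hwu : w - u ≠ 0 := by
      intro h
      rw [sub_eq_zero.mp h] at hw
      linarith
    have := (norm_le_norm_sub_mul_iff hw zero_le_one (1 / (w - u))).mp (by
      have : ((1 : ℝ) : ℂ) - w * (1 / (w - u)) = -u * (1 / (w - u)) := by
        push_cast
        field_simp
        ring
      rw [this, norm_mul, norm_neg]
      exact le_mul_of_one_le_left (norm_nonneg _) hu1)
    simpa using this
  have hsum := norm_multiset_sum_add_card_mul_le f.roots _ hroot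
  rw [← hlog, mul_one] at hsum
  set b := f.derivative.eval w / f.eval w with hb
  have hcard : f.roots.card ≤ n := (card_roots' f).trans hf
  have hcard' : (f.roots.card : ℝ) ≤ n := by exact_mod_cast hcard
  have hdisk : ‖b * ((1 - ‖w‖ ^ 2 : ℝ) : ℂ) + (n : ℝ) * conj w‖ ≤ n := by
    calc _ = ‖(b * ((1 - ‖w‖ ^ 2 : ℝ) : ℂ) + f.roots.card * conj w)
            + ((n - f.roots.card : ℝ) : ℂ) * conj w‖ := by congr 1; push_cast; ring
      _ ≤ _ := norm_add_le _ _
      _ ≤ f.roots.card + (n - f.roots.card) * 1 := by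
        refine add_le_add hsum ?_
        rw [norm_mul, Complex.norm_real, Real.norm_of_nonneg (by linarith), Complex.norm_conj]
        exact mul_le_mul_of_nonneg_left hw.le (by linarith)
      _ = n := by ring
  have hfin := (norm_le_norm_sub_mul_iff hw (Nat.cast_nonneg n) b).mpr hdisk
  have h1 : f.derivative.eval w = b * f.eval w := by rw [hb]; field_simp
  have h2 : n * f.eval w - w * f.derivative.eval w = (((n : ℝ) : ℂ) - w * b) * f.eval w := by
    rw [h1]; push_cast; ring
  rw [h2, h1, norm_mul, norm_mul]
  exact mul_le_mul_of_nonneg_right hfin (norm_nonneg _)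

/-- Laguerre's theorem for the open unit disk. -/
lemma eval_polarDeriv_ne_zero {n : ℕ} (hn : n ≠ 0) {f : ℂ[X]} (hf : f.natDegree ≤ n)
    (hf0 : ∀ w : ℂ, ‖w‖ < 1 → f.eval w ≠ 0) {α : ℂ} (hα : ‖α‖ < 1) {w : ℂ} (hw : ‖w‖ < 1) :
    (polarDeriv n α f).eval w ≠ 0 := by
  intro h
  rw [eval_polarDeriv] at h
  have h1 := norm_eval_derivative_le hf hf0 hw
  have h2 : n * f.eval w - w * f.derivative.eval w = -(α * f.derivative.eval w) := by
    linear_combination h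
  have h3 : f.derivative.eval w = 0 := by
    rw [h2, norm_neg, norm_mul] at h1
    by_contra h0
    nlinarith [norm_pos_iff.mpr h0]
  rw [h3, mul_zero, add_zero] at h
  exact mul_ne_zero (Nat.cast_ne_zero.mpr hn) (hf0 w hw) h

/-- Polar derivatives preserve domination by a polynomial without zeros in the open unit disk. -/
lemma norm_eval_polarDeriv_le {n : ℕ} (hn : n ≠ 0) {f g : ℂ[X]} (hf : f.natDegree ≤ n)
    (hg : g.natDegree ≤ n) (hf0 : ∀ w : ℂ, ‖w‖ < 1 → f.eval w ≠ 0)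
    (hgf : ∀ w : ℂ, ‖w‖ < 1 → ‖g.eval w‖ ≤ ‖f.eval w‖) {α : ℂ} (hα : ‖α‖ < 1)
    {w : ℂ} (hw : ‖w‖ < 1) :
    ‖(polarDeriv n α g).eval w‖ ≤ ‖(polarDeriv n α f).eval w‖ := by
  by_contra! hlt
  have hTf := eval_polarDeriv_ne_zero hn hf hf0 hα hw
  set c := (polarDeriv n α g).eval w / (polarDeriv n α f).eval w with hc
  have hc1 : 1 < ‖c‖ := by
    rw [hc, norm_div]
    exact (one_lt_div (norm_pos_iff.mpr hTf)).mpr hlt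
  refine eval_polarDeriv_ne_zero hn (f := g - C c * f) ?_ ?_ hα hw ?_
  · simpa using natDegree_sub_le_of_le hg ((natDegree_C_mul_le c f).trans hf)
  · intro v hv h
    rw [eval_sub, eval_C_mul, sub_eq_zero] at h
    have h1 := hgf v hv
    rw [h, norm_mul] at h1
    nlinarith [norm_pos_iff.mpr (hf0 v hv)]
  · rw [polarDeriv_sub, polarDeriv_C_mul, eval_sub, eval_C_mul, hc, div_mul_cancel₀ _ hTf, sub_self]

lemma eval_eq_pow_mul_eval_reflect {n : ℕ} {P : ℂ[X]} (hP : P.natDegree ≤ n) {z : ℂ}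
    (hz : z ≠ 0) : P.eval z = z ^ n * (P.reflect n).eval z⁻¹ := by
  let _ := invertibleOfNonzero hz
  have := eval₂_reflect_mul_pow (RingHom.id ℂ) z n P hP
  rw [invOf_eq_inv] at this
  rw [eval, eval, ← this, mul_comm]

lemma eval_reflect_eq_pow_mul {n : ℕ} {P : ℂ[X]} (hP : P.natDegree ≤ n) {w : ℂ}
    (hw : w ≠ 0) : (P.reflect n).eval w = w ^ n * P.eval w⁻¹ := by
  rw [eval_eq_pow_mul_eval_reflect hP (inv_ne_zero hw), inv_inv, ← mul_assoc, ← mul_pow,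
    mul_inv_cancel₀ hw, one_pow, one_mul]

lemma eval_map_conj (P : ℂ[X]) (w : ℂ) :
    (P.map (starRingEnd ℂ)).eval w = conj (P.eval (conj w)) := by
  rw [eval_map, eval, hom_eval₂, Complex.conj_conj, RingHom.comp_id]

lemma norm_eval_eq_prod_roots (P : ℂ[X]) (w : ℂ) :
    ‖P.eval w‖ = ‖P.leadingCoeff‖ * (P.roots.map fun u => ‖w - u‖).prod := by
  conv_lhs => rw [(IsAlgClosed.splits P).eval_eq_prod_roots]
  rw [norm_mul]
  congr 1
  induction P.roots using Multiset.induction_on with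
  | empty => simp
  | cons u s ih => simp [ih]

/-- A polynomial without zeros in the open unit disk dominates its reciprocal there. -/
lemma norm_eval_reflect_le {n : ℕ} {P : ℂ[X]} (hP : P.natDegree ≤ n)
    (hP0 : ∀ w : ℂ, ‖w‖ < 1 → P.eval w ≠ 0) {w : ℂ} (hw : ‖w‖ < 1) :
    ‖(P.reflect n).eval w‖ ≤ ‖(P.map (starRingEnd ℂ)).eval w‖ := by
  have hne : ∀ v : ℂ, v ≠ 0 → ‖v‖ < 1 →
      ‖(P.reflect n).eval v‖ ≤ ‖(P.map (starRingEnd ℂ)).eval v‖ := by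
    intro v hv0 hv
    have hcard : P.roots.card ≤ n := (card_roots' P).trans hP
    rw [eval_reflect_eq_pow_mul hP hv0, eval_map_conj, Complex.norm_conj, norm_mul, norm_pow,
      norm_eval_eq_prod_roots, norm_eval_eq_prod_roots, mul_left_comm]
    refine mul_le_mul_of_nonneg_left ?_ (norm_nonneg _)
    calc ‖v‖ ^ n * (P.roots.map fun u => ‖v⁻¹ - u‖).prod
        ≤ ‖v‖ ^ P.roots.card * (P.roots.map fun u => ‖v⁻¹ - u‖).prod := by
          refine mul_le_mul_of_nonneg_right
            (pow_le_pow_of_le_one (norm_nonneg _) hv.le hcard) (Multiset.prod_nonneg ?_)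
          simp only [Multiset.mem_map]
          rintro _ ⟨u, -, rfl⟩
          exact norm_nonneg _
      _ = (P.roots.map fun u => ‖1 - v * u‖).prod := by
          rw [← Multiset.prod_replicate, ← Multiset.map_const', ← Multiset.prod_map_mul]
          simp only [← norm_mul, mul_sub, mul_inv_cancel₀ hv0]
      _ ≤ (P.roots.map fun u => ‖conj v - u‖).prod := by
          refine Multiset.prod_map_le_prod_map₀ _ _ (fun _ _ => norm_nonneg _) fun u hu => ?_
          refine norm_one_sub_mul_le hv.le ?_
          by_contra! h
          exact hP0 u h (isRoot_of_mem_roots hu)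
  rcases eq_or_ne w 0 with rfl | hw0
  · have hlim : ∀ f : ℂ[X], Tendsto (fun v => ‖f.eval v‖) (𝓝[≠] 0) (𝓝 ‖f.eval 0‖) := fun f =>
      (f.continuous.norm.tendsto 0).mono_left nhdsWithin_le_nhds
    refine le_of_tendsto_of_tendsto (hlim _) (hlim _) ?_
    filter_upwards [self_mem_nhdsWithin,
      nhdsWithin_le_nhds (Metric.ball_mem_nhds (0 : ℂ) one_pos)] with v hv hv1
    exact hne v hv (by simpa using hv1)
  · exact hne w hw0 hw

lemma smirnov_eq_pow_mul_polarDeriv {n : ℕ} (hn : n ≠ 0) {P : ℂ[X]} (hP : P.natDegree ≤ n)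
    (a : ℂ) {z : ℂ} (hz : z ≠ 0) :
    smirnov n a P z = z ^ (n - 1) * (polarDeriv n (-a) (P.reflect n)).eval z⁻¹ := by
  have h1 : HasDerivAt (fun x => x ^ n * (P.reflect n).eval x⁻¹)
      (n * z ^ (n - 1) * (P.reflect n).eval z⁻¹
        + z ^ n * ((P.reflect n).derivative.eval z⁻¹ * (-(z ^ 2)⁻¹))) z :=
    (hasDerivAt_pow n z).mul
      (((P.reflect n).hasDerivAt z⁻¹).comp z (hasDerivAt_inv hz))
  have h2 : (fun x => x ^ n * (P.reflect n).eval x⁻¹) =ᶠ[𝓝 z] fun x => P.eval x := by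
    filter_upwards [isOpen_ne.mem_nhds hz] with x hx
    exact (eval_eq_pow_mul_eval_reflect hP hx).symm
  have h3 := (h1.congr_of_eventuallyEq h2.symm).unique (P.hasDerivAt z)
  rw [smirnov, ← h3, eval_eq_pow_mul_eval_reflect hP hz, eval_polarDeriv]
  obtain ⟨m, rfl⟩ := Nat.exists_eq_succ_of_ne_zero hn
  simp only [Nat.succ_eq_add_one, Nat.add_sub_cancel, pow_succ]
  field_simp
  ring

lemma norm_eval_le_maxCircle (P : ℂ[X]) {w : ℂ} (hw : ‖w‖ ≤ 1) :
    ‖P.eval w‖ ≤ maxCircle P := by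
  have hbdd : BddAbove {y : ℝ | ∃ w : ℂ, ‖w‖ = 1 ∧ y = ‖P.eval w‖} := by
    refine ((isCompact_sphere (0 : ℂ) 1).bddAbove_image
      (f := fun w => ‖P.eval w‖) P.continuous.norm.continuousOn).mono ?_
    rintro _ ⟨v, hv, rfl⟩
    exact ⟨v, by simpa using hv, rfl⟩
  refine Complex.norm_le_of_forall_mem_frontier_norm_le (U := Metric.ball (0 : ℂ) 1)
    Metric.isBounded_ball P.differentiable.diffContOnCl (fun v hv => ?_) ?_
  · rw [frontier_ball _ one_ne_zero] at hv
    exact le_csSup hbdd ⟨v, by simpa using hv, rfl⟩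
  · rw [closure_ball _ one_ne_zero]
    simpa using hw

lemma eval_polarDeriv_reflect_C {n : ℕ} (α c w : ℂ) :
    (polarDeriv n α ((C c).reflect n)).eval w = c * (n * α * w ^ (n - 1)) := by
  rw [reflect_C, eval_polarDeriv]
  simp only [eval_mul, eval_C, eval_pow, eval_X, derivative_C_mul, derivative_X_pow]
  rcases n with _ | m
  · simp
  · simp only [Nat.add_sub_cancel, pow_succ]
    ring

/-- The polar derivatives of the reciprocal and of the conjugate of `P` satisfy a joint
Bernstein inequality in the open unit disk. -/
lemma norm_polarDeriv_reflect_add_norm_polarDeriv_map_conj_le {n : ℕ} (hn : n ≠ 0) {P : ℂ[X]}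
    (hP : P.natDegree ≤ n) {M : ℝ} (hM : 0 < M) (hPM : ∀ w : ℂ, ‖w‖ < 1 → ‖P.eval w‖ ≤ M)
    {α : ℂ} (hα : ‖α‖ < 1) {w : ℂ} (hw : ‖w‖ < 1) :
    ‖(polarDeriv n α (P.reflect n)).eval w‖
      + ‖(polarDeriv n α (P.map (starRingEnd ℂ))).eval w‖
      ≤ n * M * (1 + ‖α‖ * ‖w‖ ^ (n - 1)) := by
  set A := (polarDeriv n α (P.reflect n)).eval w with hA
  set B := (polarDeriv n α (P.map (starRingEnd ℂ))).eval w with hB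
  have hTC : ∀ c : ℂ, (polarDeriv n α (C c)).eval w = n * c := fun c => by
    simp [eval_polarDeriv]
  have hBM : ‖B‖ ≤ n * M := by
    have := norm_eval_polarDeriv_le hn (f := C (M : ℂ)) (g := P.map (starRingEnd ℂ))
      (by simp) (natDegree_map_le.trans hP) (by simp [hM.ne'])
      (fun v hv => by
        rw [eval_map_conj, Complex.norm_conj, eval_C, Complex.norm_real,
          Real.norm_of_nonneg hM.le]
        exact hPM _ (by rwa [Complex.norm_conj])) hα hw
    rw [hTC] at this
    simpa [abs_of_pos hM] using this
  obtain ⟨e, he, hBe⟩ : ∃ e : ℂ, ‖e‖ = 1 ∧ B = ‖B‖ * e := by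
    refine ⟨Complex.exp (B.arg * Complex.I), Complex.norm_exp_ofReal_mul_I _, ?_⟩
    exact (Complex.norm_mul_exp_arg_mul_I B).symm
  have hr : ∀ r : ℝ, 1 < r → ‖A‖ + ‖B‖ ≤ r * (n * M * (1 + ‖α‖ * ‖w‖ ^ (n - 1))) := by
    intro r hr
    have hr0 : 0 < r := by linarith
    set c : ℂ := (r * M : ℝ) * conj e with hc
    have hcn : ‖c‖ = r * M := by
      rw [hc, norm_mul, Complex.norm_conj, he, Complex.norm_real,
        Real.norm_of_nonneg (by positivity), mul_one]
    have hdeg : (P - C c).natDegree ≤ n := by rwa [natDegree_sub_C]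
    have hnz : ∀ v : ℂ, ‖v‖ < 1 → (P - C c).eval v ≠ 0 := by
      intro v hv h
      rw [eval_sub, eval_C, sub_eq_zero] at h
      have := hPM v hv
      rw [h, hcn] at this
      nlinarith
    have hcmp := norm_eval_polarDeriv_le hn (f := (P - C c).map (starRingEnd ℂ))
      (g := (P - C c).reflect n) (natDegree_map_le.trans hdeg)
      ((natDegree_reflect_le).trans (by simpa using hdeg))
      (fun v hv => by
        rw [eval_map_conj, _root_.map_ne_zero]
        exact hnz _ (by rwa [Complex.norm_conj]))
      (fun v hv => norm_eval_reflect_le hdeg hnz hv) hα hw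
    rw [reflect_sub, Polynomial.map_sub, map_C, polarDeriv_sub, polarDeriv_sub, eval_sub, eval_sub,
      eval_polarDeriv_reflect_C, hTC, ← hA, ← hB] at hcmp
    have hR : ‖B - n * conj c‖ = r * (n * M) - ‖B‖ := by
      have : B - n * conj c = ((‖B‖ - r * (n * M) : ℝ) : ℂ) * e := by
        rw [hc, map_mul, Complex.conj_conj, Complex.conj_ofReal]
        conv_lhs => rw [hBe]
        push_cast
        ring
      rw [this, norm_mul, he, mul_one, Complex.norm_real, Real.norm_of_nonpos, neg_sub]
      nlinarith [show 0 ≤ n * M by positivity]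
    have hL : ‖A‖ - r * M * (n * ‖α‖ * ‖w‖ ^ (n - 1)) ≤ ‖A - c * (n * α * w ^ (n - 1))‖ := by
      have := norm_sub_norm_le A (c * (n * α * w ^ (n - 1)))
      simpa only [norm_mul, norm_pow, hcn, Complex.norm_natCast] using this
    rw [hR] at hcmp
    linarith
  have hlim : Tendsto (fun r : ℝ => r * (n * M * (1 + ‖α‖ * ‖w‖ ^ (n - 1)))) (𝓝[>] 1)
      (𝓝 (1 * (n * M * (1 + ‖α‖ * ‖w‖ ^ (n - 1))))) :=
    ((continuous_mul_const _).tendsto 1).mono_left nhdsWithin_le_nhds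
  rw [one_mul] at hlim
  exact ge_of_tendsto hlim (eventually_mem_nhdsWithin.mono hr)

lemma norm_smirnov_le_of_lt {n : ℕ} (hn : n ≠ 0) {P : ℂ[X]} (hP : P.natDegree ≤ n)
    (hP0 : ∀ w : ℂ, ‖w‖ < 1 → P.eval w ≠ 0) {a : ℂ} (ha : ‖a‖ < 1) {z : ℂ} (hz : 1 < ‖z‖) :
    ‖smirnov n a P z‖ ≤ (1 / 2) * (n * ‖z‖ ^ (n - 1) + n * ‖a‖) * maxCircle P := by
  have hz0 : z ≠ 0 := norm_pos_iff.mp (by linarith)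
  have hw : ‖z⁻¹‖ < 1 := by
    rw [norm_inv]
    exact inv_lt_one_of_one_lt₀ hz
  have hα : ‖-a‖ < 1 := by rwa [norm_neg]
  have hM : 0 < maxCircle P :=
    (norm_pos_iff.mpr (hP0 0 (by simp))).trans_le (norm_eval_le_maxCircle P (by simp))
  have h1 := norm_polarDeriv_reflect_add_norm_polarDeriv_map_conj_le hn hP hM
    (fun v hv => norm_eval_le_maxCircle P hv.le) hα hw
  have h2 := norm_eval_polarDeriv_le hn (f := P.map (starRingEnd ℂ)) (g := P.reflect n)
    (natDegree_map_le.trans hP) (natDegree_reflect_le.trans (by simpa using hP))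
    (fun v hv => by
      rw [eval_map_conj, _root_.map_ne_zero]
      exact hP0 _ (by rwa [Complex.norm_conj]))
    (fun v hv => norm_eval_reflect_le hP hP0 hv) hα hw
  rw [smirnov_eq_pow_mul_polarDeriv hn hP a hz0, norm_mul, norm_pow]
  have hpow : ‖z‖ ^ (n - 1) * ‖z⁻¹‖ ^ (n - 1) = 1 := by
    rw [← mul_pow, norm_inv, mul_inv_cancel₀ (norm_ne_zero_iff.mpr hz0), one_pow]
  rw [norm_neg] at h1
  calc _ ≤ ‖z‖ ^ (n - 1) * (1 / 2 * (n * maxCircle P * (1 + ‖a‖ * ‖z⁻¹‖ ^ (n - 1)))) := by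
        gcongr
        linarith
    _ = 1 / 2 * (n * ‖z‖ ^ (n - 1) + n * ‖a‖ * (‖z‖ ^ (n - 1) * ‖z⁻¹‖ ^ (n - 1)))
          * maxCircle P := by ring
    _ = _ := by rw [hpow, mul_one]

theorem statement19 (n : ℕ) (P : Polynomial ℂ) (hP : P.natDegree = n)
    (hP0 : ∀ w : ℂ, ‖w‖ < 1 → P.eval w ≠ 0)
    (a : ℂ) (ha : ‖a‖ ≤ 1) (z : ℂ) (hz : 1 ≤ ‖z‖) :
    ‖(1 + a * z) * P.derivative.eval z - (n : ℂ) * a * P.eval z‖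
      ≤ (1 / 2) * ((n : ℝ) * ‖z‖ ^ (n - 1) + (n : ℝ) * ‖a‖) * maxCircle P := by
  rcases eq_or_ne n 0 with rfl | hn
  · rw [eq_C_of_natDegree_eq_zero hP]
    simp
  let a' : ℝ → ℂ := fun s => (1 - s : ℝ) * a
  let z' : ℝ → ℂ := fun s => (1 + s : ℝ) * z
  have hev : ∀ᶠ s in 𝓝[>] (0 : ℝ), ‖smirnov n (a' s) P (z' s)‖ ≤
      (1 / 2) * (n * ‖z' s‖ ^ (n - 1) + n * ‖a' s‖) * maxCircle P := by
    filter_upwards [Ioo_mem_nhdsGT (zero_lt_one (α := ℝ))] with s hs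
    refine norm_smirnov_le_of_lt hn hP.le hP0 ?_ ?_
    · rw [norm_mul, Complex.norm_real, Real.norm_of_nonneg (by linarith [hs.2])]
      nlinarith [hs.1, hs.2, norm_nonneg a]
    · rw [norm_mul, Complex.norm_real, Real.norm_of_nonneg (by linarith [hs.1])]
      nlinarith [hs.1]
  have hl : Continuous fun s => ‖smirnov n (a' s) P (z' s)‖ := by
    simp only [smirnov, a', z']
    fun_prop
  have hr : Continuous fun s =>
      (1 / 2) * (n * ‖z' s‖ ^ (n - 1) + n * ‖a' s‖) * maxCircle P := by
    simp only [a', z']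
    fun_prop
  simpa [a', z', smirnov] using le_of_tendsto_of_tendsto
    ((hl.tendsto 0).mono_left nhdsWithin_le_nhds)
    ((hr.tendsto 0).mono_left nhdsWithin_le_nhds) hev
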